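/- Let S be a finite set, let W, η : S → ℝ_{>0} satisfy ∑_{a∈S} W(a)·η(a) ≤ 1, and let k ≥ 1 be a real number. Let 𝒳 be a finite family of subsets R ⊆ S, each satisfying ∑_{a∈R} η(a) ≥ 1 and 2·η(a)·k ≤ 1 for every a ∈ R, and let Q be a probability distribution on 𝒳. Then there exists a subset G ⊆ S such that ∑_{R∈𝒳, R∩G=∅} Q(R) ≤ e^{−k} and ∑_{a∈G} W(a) ≤ 4k. -/

import Mathlib

open scoped BigOperators

/-- A function that is concave along each coordinate of `[0, 1]^S` is, at any point, at least its
value at some vertex of the cube. -/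
theorem exists_vertex_le {α : Type*} [DecidableEq α] (F : (α → ℝ) → ℝ)
    (hF : ∀ (x : α → ℝ) (a : α) (t : ℝ), t ∈ Set.Icc 0 1 →
      (1 - t) * F (Function.update x a 0) + t * F (Function.update x a 1) ≤
        F (Function.update x a t))
    (S : Finset α) (x : α → ℝ) (hx : ∀ a ∈ S, x a ∈ Set.Icc 0 1) :
    ∃ G ⊆ S, F (fun a => if a ∈ S then (if a ∈ G then 1 else 0) else x a) ≤ F x := by
  induction S using Finset.induction_on generalizing x with
  | empty => exact ⟨∅, by simp⟩
  | insert b S hb ih =>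
    obtain ⟨h0, h1⟩ := hx b (Finset.mem_insert_self b S)
    have hmin : F (Function.update x b 0) ≤ F x ∨ F (Function.update x b 1) ≤ F x := by
      have h := hF x b (x b) ⟨h0, h1⟩
      rw [Function.update_eq_self] at h
      by_contra! hlt
      obtain ⟨hlt0, hlt1⟩ := hlt
      rcases h0.eq_or_lt with hz | hpos
      · rw [← hz] at h
        linarith
      · nlinarith [mul_pos hpos (sub_pos.2 hlt1),
          mul_nonneg (sub_nonneg.2 h1) (sub_pos.2 hlt0).le]
    have hstep (c : ℝ) : ∀ a ∈ S, Function.update x b c a ∈ Set.Icc (0 : ℝ) 1 := by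
      intro a ha
      rw [Function.update_of_ne (ne_of_mem_of_not_mem ha hb)]
      exact hx a (Finset.mem_insert_of_mem ha)
    rcases hmin with hle | hle
    · obtain ⟨G, hGS, hG⟩ := ih _ (hstep 0)
      refine ⟨G, hGS.trans (Finset.subset_insert b S), le_trans (le_of_eq ?_) (hG.trans hle)⟩
      congr 1
      funext a
      by_cases hab : a = b
      · subst hab
        simp [hb, Finset.notMem_mono hGS hb]
      · simp [hab]
    · obtain ⟨G, hGS, hG⟩ := ih _ (hstep 1)
      refine ⟨insert b G, Finset.insert_subset_insert b hGS,
        le_trans (le_of_eq ?_) (hG.trans hle)⟩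
      congr 1
      funext a
      by_cases hab : a = b
      · subst hab
        simp [hb]
      · simp [hab]

theorem prod_one_sub_update {α : Type*} [DecidableEq α] (R : Finset α) (x : α → ℝ) (a : α)
    (t : ℝ) :
    ∏ b ∈ R, (1 - Function.update x a t b) =
      (1 - t) * ∏ b ∈ R, (1 - Function.update x a 0 b) +
        t * ∏ b ∈ R, (1 - Function.update x a 1 b) := by
  by_cases ha : a ∈ R
  · have h (c : ℝ) : ∏ b ∈ R, (1 - Function.update x a c b) =
        (1 - c) * ∏ b ∈ R.erase a, (1 - x b) := by
      rw [← Finset.mul_prod_erase R _ ha, Function.update_self]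
      congr 1
      refine Finset.prod_congr rfl fun b hb => ?_
      rw [Function.update_of_ne (Finset.ne_of_mem_erase hb)]
    rw [h, h, h]
    ring
  · have h (c : ℝ) : ∏ b ∈ R, (1 - Function.update x a c b) = ∏ b ∈ R, (1 - x b) := by
      refine Finset.prod_congr rfl fun b hb => ?_
      rw [Function.update_of_ne (ne_of_mem_of_not_mem hb ha)]
    rw [h, h, h]
    ring

theorem update_eq_affine {α : Type*} [DecidableEq α] (x : α → ℝ) (a b : α) (t : ℝ) :
    Function.update x a t b =
      (1 - t) * Function.update x a 0 b + t * Function.update x a 1 b := by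
  by_cases h : b = a
  · subst h
    simp
  · simp only [Function.update_of_ne h]
    ring

/-- **probabilistic method lemma.** Let `S` be a finite set,
`W, η : S → ℝ_{>0}` with `∑_{a∈S} W(a)η(a) ≤ 1`, and `k ≥ 1`. Let `𝒳` be a
finite family of subsets `R ⊆ S`, each with `∑_{a∈R} η(a) ≥ 1` and
`2·η(a)·k ≤ 1` for all `a ∈ R`, and let `Q` be a probability distribution
on `𝒳`. Then there is `G ⊆ S` with `∑_{R∈𝒳, R∩G=∅} Q(R) ≤ e^{−k}` and
`∑_{a∈G} W(a) ≤ 4k`. -/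
theorem exists_hitting_set {α : Type*} [DecidableEq α]
    (S : Finset α) (W η : α → ℝ) (k : ℝ)
    (hW : ∀ a ∈ S, 0 < W a) (hη : ∀ a ∈ S, 0 < η a)
    (hWη : ∑ a ∈ S, W a * η a ≤ 1) (hk : 1 ≤ k)
    (𝒳 : Finset (Finset α)) (Q : Finset α → ℝ)
    (h𝒳S : ∀ R ∈ 𝒳, R ⊆ S)
    (h𝒳η : ∀ R ∈ 𝒳, 1 ≤ ∑ a ∈ R, η a)
    (h𝒳k : ∀ R ∈ 𝒳, ∀ a ∈ R, 2 * η a * k ≤ 1)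
    (hQ0 : ∀ R ∈ 𝒳, 0 ≤ Q R) (hQ1 : ∑ R ∈ 𝒳, Q R = 1) :
    ∃ G ⊆ S, (∑ R ∈ 𝒳.filter fun R => R ∩ G = ∅, Q R) ≤ Real.exp (-k) ∧
      ∑ a ∈ G, W a ≤ 4 * k := by
  have hk0 : 0 < k := by linarith
  let F : (α → ℝ) → ℝ := fun x =>
    Real.exp k * ∑ R ∈ 𝒳, Q R * ∏ a ∈ R, (1 - x a) + (∑ a ∈ S, W a * x a) / (4 * k)
  let p : α → ℝ := fun a => min 1 (2 * η a * k)
  have hF : ∀ (x : α → ℝ) (a : α) (t : ℝ), t ∈ Set.Icc 0 1 →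
      (1 - t) * F (Function.update x a 0) + t * F (Function.update x a 1) ≤
        F (Function.update x a t) := by
    intro x a t _
    have h1 : ∑ R ∈ 𝒳, Q R * ∏ b ∈ R, (1 - Function.update x a t b) =
        (1 - t) * ∑ R ∈ 𝒳, Q R * ∏ b ∈ R, (1 - Function.update x a 0 b) +
          t * ∑ R ∈ 𝒳, Q R * ∏ b ∈ R, (1 - Function.update x a 1 b) := by
      rw [Finset.mul_sum, Finset.mul_sum, ← Finset.sum_add_distrib]
      refine Finset.sum_congr rfl fun R _ => ?_
      rw [prod_one_sub_update]
      ring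
    have h2 : ∑ b ∈ S, W b * Function.update x a t b =
        (1 - t) * ∑ b ∈ S, W b * Function.update x a 0 b +
          t * ∑ b ∈ S, W b * Function.update x a 1 b := by
      rw [Finset.mul_sum, Finset.mul_sum, ← Finset.sum_add_distrib]
      refine Finset.sum_congr rfl fun b _ => ?_
      rw [update_eq_affine]
      ring
    simp only [F]
    rw [h1, h2]
    exact le_of_eq (by ring)
  have hp : ∀ a ∈ S, p a ∈ Set.Icc (0 : ℝ) 1 := fun a ha =>
    ⟨le_min zero_le_one (by have := hη a ha; positivity), min_le_left _ _⟩
  have hmiss : ∑ R ∈ 𝒳, Q R * ∏ a ∈ R, (1 - p a) ≤ Real.exp (-(2 * k)) := by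
    calc ∑ R ∈ 𝒳, Q R * ∏ a ∈ R, (1 - p a)
        ≤ ∑ R ∈ 𝒳, Q R * Real.exp (-(2 * k)) := by
          refine Finset.sum_le_sum fun R hR => mul_le_mul_of_nonneg_left ?_ (hQ0 R hR)
          calc ∏ a ∈ R, (1 - p a) ≤ ∏ a ∈ R, Real.exp (-(2 * η a * k)) := by
                refine Finset.prod_le_prod
                  (fun a ha => sub_nonneg.2 (hp a (h𝒳S R hR ha)).2) fun a ha => ?_
                simp only [p, min_eq_right (h𝒳k R hR a ha)]
                exact Real.one_sub_le_exp_neg _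
            _ = Real.exp (-(2 * k * ∑ a ∈ R, η a)) := by
                rw [← Real.exp_sum, Finset.mul_sum, ← Finset.sum_neg_distrib]
                congr 1
                exact Finset.sum_congr rfl fun a _ => by ring
            _ ≤ Real.exp (-(2 * k)) := by
                refine Real.exp_le_exp.2 (neg_le_neg ?_)
                exact le_mul_of_one_le_right (by positivity) (h𝒳η R hR)
      _ = Real.exp (-(2 * k)) := by rw [← Finset.sum_mul, hQ1, one_mul]
  have hweight : ∑ a ∈ S, W a * p a ≤ 2 * k := by
    calc ∑ a ∈ S, W a * p a ≤ ∑ a ∈ S, 2 * k * (W a * η a) := by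
          refine Finset.sum_le_sum fun a ha => ?_
          calc W a * p a ≤ W a * (2 * η a * k) :=
                mul_le_mul_of_nonneg_left (min_le_right _ _) (hW a ha).le
            _ = 2 * k * (W a * η a) := by ring
      _ ≤ 2 * k := by
          rw [← Finset.mul_sum]
          exact mul_le_of_le_one_right (by positivity) hWη
  have hFp : F p ≤ 1 := by
    have h1 : Real.exp k * ∑ R ∈ 𝒳, Q R * ∏ a ∈ R, (1 - p a) ≤ 1 / 2 := by
      calc Real.exp k * ∑ R ∈ 𝒳, Q R * ∏ a ∈ R, (1 - p a)
          ≤ Real.exp k * Real.exp (-(2 * k)) :=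
            mul_le_mul_of_nonneg_left hmiss (Real.exp_pos k).le
        _ = (Real.exp k)⁻¹ := by
            rw [← Real.exp_add, ← Real.exp_neg]
            ring_nf
        _ ≤ 1 / 2 := by
            rw [one_div]
            exact inv_anti₀ two_pos (by linarith [Real.add_one_le_exp k])
    have h2 : (∑ a ∈ S, W a * p a) / (4 * k) ≤ 1 / 2 := by
      rw [div_le_iff₀ (by positivity)]
      linarith
    simp only [F]
    linarith
  obtain ⟨G, hGS, hG⟩ := exists_vertex_le F hF S p hp
  have hmass : ∑ R ∈ 𝒳, Q R * ∏ a ∈ R, (1 - if a ∈ S then (if a ∈ G then 1 else 0) else p a) =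
      ∑ R ∈ 𝒳.filter fun R => R ∩ G = ∅, Q R := by
    rw [Finset.sum_filter]
    refine Finset.sum_congr rfl fun R hR => ?_
    split_ifs with h
    · rw [Finset.prod_eq_one, mul_one]
      intro a ha
      have haG : a ∉ G := fun haG => by
        simpa [h] using Finset.mem_inter.2 ⟨ha, haG⟩
      simp [h𝒳S R hR ha, haG]
    · obtain ⟨a, ha⟩ := Finset.nonempty_iff_ne_empty.2 h
      obtain ⟨haR, haG⟩ := Finset.mem_inter.1 ha
      rw [Finset.prod_eq_zero haR (by simp [hGS haG, haG]), mul_zero]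
  have hcost : ∑ a ∈ S, W a * (if a ∈ S then (if a ∈ G then 1 else 0) else p a) =
      ∑ a ∈ G, W a := by
    rw [← Finset.sum_subset hGS]
    · exact Finset.sum_congr rfl fun a ha => by simp [hGS ha, ha]
    · intro a haS haG
      simp [haS, haG]
  have hle := hG.trans hFp
  simp only [F] at hle
  rw [hmass, hcost] at hle
  have hmass0 : 0 ≤ ∑ R ∈ 𝒳.filter fun R => R ∩ G = ∅, Q R :=
    Finset.sum_nonneg fun R hR => hQ0 R (Finset.mem_filter.1 hR).1
  have hcost0 : 0 ≤ ∑ a ∈ G, W a := Finset.sum_nonneg fun a ha => (hW a (hGS ha)).le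
  refine ⟨G, hGS, ?_, ?_⟩
  · rw [Real.exp_neg, ← one_div, le_div_iff₀' (Real.exp_pos k)]
    have : 0 ≤ (∑ a ∈ G, W a) / (4 * k) := by positivity
    linarith
  · have : 0 ≤ Real.exp k * ∑ R ∈ 𝒳.filter fun R => R ∩ G = ∅, Q R := by positivity
    rw [← div_le_one (by positivity)]
    linarith
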